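/- Let d = 2m+1 be odd and let the parameter function be constant, k_j = c for all j. Assume that c is NOT of the form r/d for any positive integer r not divisible by d, and NOT of the form n + 1/2 for any integer n ≥ 0. Then every polynomial f ∈ ℂ[Z,W] with D_Z(f) = 0 and D_W(f) = 0 is a constant. -/

import Mathlib

open MvPolynomial
open scoped Classical

noncomputable section

/-- The polynomial ring `ℂ[Z,W]`, with `Z = X 0` and `W = X 1`. -/
abbrev R2 : Type := MvPolynomial (Fin 2) ℂ

/-- `ζ = exp(2πi/d)`. -/
def zeta (d : ℕ) : ℂ := Complex.exp (2 * Real.pi * Complex.I / d)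

/-- The action of the reflection `s_j` of `I₂(d)` on `ℂ[Z,W]`:
`Z ↦ ζ^j·W`, `W ↦ ζ^{-j}·Z`. -/
def reflAct (d j : ℕ) : R2 →ₐ[ℂ] R2 :=
  aeval ![C (zeta d ^ j) * X 1, C ((zeta d ^ j)⁻¹) * X 0]

/-- Exact division: if `a ∣ b` in `ℂ[Z,W]` this is the (unique, when `a ≠ 0`)
quotient, and `0` otherwise. -/
def exQuot (a b : R2) : R2 := if h : ∃ c, b = a * c then Classical.choose h else 0

/-- The Dunkl operator `D_Z` with parameters `k₁,…,k_d`. -/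
def DZ (d : ℕ) (k : ℕ → ℂ) (f : R2) : R2 :=
  pderiv (0 : Fin 2) f - ∑ j ∈ Finset.Icc 1 d,
    C (k j) * exQuot (X 0 - C (zeta d ^ j) * X 1) (f - reflAct d j f)

/-- The Dunkl operator `D_W` with parameters `k₁,…,k_d`. -/
def DW (d : ℕ) (k : ℕ → ℂ) (f : R2) : R2 :=
  pderiv (1 : Fin 2) f - ∑ j ∈ Finset.Icc 1 d,
    C (k j) * exQuot (X 1 - C ((zeta d ^ j)⁻¹) * X 0) (f - reflAct d j f)

/-- The exponent of the monomial `Z ^ a * W ^ b`. -/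
def expo (a b : ℕ) : Fin 2 →₀ ℕ := Finsupp.single 0 a + Finsupp.single 1 b

theorem expo_zero (a b : ℕ) : expo a b 0 = a := by simp [expo]

theorem expo_one (a b : ℕ) : expo a b 1 = b := by simp [expo]

theorem expo_apply_self (s : Fin 2 →₀ ℕ) : expo (s 0) (s 1) = s := by
  ext i; fin_cases i <;> simp [expo]

theorem expo_inj {a b a' b' : ℕ} : expo a b = expo a' b' ↔ a = a' ∧ b = b' := by
  refine ⟨fun h => ⟨?_, ?_⟩, fun h => by rw [h.1, h.2]⟩
  · simpa [expo_zero] using DFunLike.congr_fun h 0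
  · simpa [expo_one] using DFunLike.congr_fun h 1

theorem expo_succ_left (a b : ℕ) : expo (a + 1) b = Finsupp.single 0 1 + expo a b := by
  ext i; fin_cases i <;> simp [expo, add_comm]

theorem expo_succ_right (a b : ℕ) : expo a (b + 1) = Finsupp.single 1 1 + expo a b := by
  ext i; fin_cases i <;> simp [expo, add_comm]

theorem coeff_reflAct (d j : ℕ) (f : R2) (p q : ℕ) :
    coeff (expo p q) (reflAct d j f) =
      (zeta d ^ j) ^ q * ((zeta d ^ j)⁻¹) ^ p * coeff (expo q p) f := by
  induction f using MvPolynomial.induction_on' with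
  | add f g hf hg => simp only [map_add, coeff_add, hf, hg, mul_add]
  | monomial s r =>
    rw [← expo_apply_self s]
    generalize s 0 = a
    generalize s 1 = b
    have : reflAct d j (monomial (expo a b) r) =
        monomial (expo b a) ((zeta d ^ j) ^ a * ((zeta d ^ j)⁻¹) ^ b * r) := by
      rw [reflAct, aeval_monomial, Finsupp.prod_fintype _ _ (fun _ => pow_zero _)]
      rw [Fin.prod_univ_two, expo_zero, expo_one, expo, monomial_add_single, algebraMap_eq]
      rw [← C_mul_X_pow_eq_monomial]
      simp only [Matrix.cons_val_zero, Matrix.cons_val_one, mul_pow, map_mul, map_pow]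
      ring
    rw [this, coeff_monomial, coeff_monomial]
    simp only [expo_inj]
    by_cases h : b = p ∧ a = q
    · rw [if_pos h, if_pos h.symm, h.1, h.2]
    · rw [if_neg h, if_neg (fun h' => h h'.symm), mul_zero]

theorem dvd_sub_reflAct (d j : ℕ) (f : R2) :
    X 0 - C (zeta d ^ j) * X 1 ∣ f - reflAct d j f := by
  have hz : zeta d ^ j ≠ 0 := pow_ne_zero _ (Complex.exp_ne_zero _)
  let I : Ideal R2 := Ideal.span {X 0 - C (zeta d ^ j) * X 1}
  rw [← Ideal.mem_span_singleton]
  change _ ∈ I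
  rw [← Ideal.Quotient.eq]
  suffices h : Ideal.Quotient.mkₐ ℂ I = (Ideal.Quotient.mkₐ ℂ I).comp (reflAct d j) from
    DFunLike.congr_fun h f
  refine MvPolynomial.algHom_ext fun i => ?_
  rw [AlgHom.comp_apply, Ideal.Quotient.mkₐ_eq_mk, Ideal.Quotient.eq, Ideal.mem_span_singleton]
  fin_cases i
  · simp [reflAct]
  · refine ⟨-C (zeta d ^ j)⁻¹, ?_⟩
    have hC : (C (zeta d ^ j)⁻¹ : R2) * C (zeta d ^ j) = 1 := by
      rw [← C_mul, inv_mul_cancel₀ hz, C_1]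
    simp only [reflAct, Fin.mk_one, aeval_X, Matrix.cons_val_one, Matrix.cons_val_fin_one]
    linear_combination -(X 1 : R2) * hC

theorem mul_exQuot {a b : R2} (h : a ∣ b) : a * exQuot a b = b := by
  have h' : ∃ c, b = a * c := h
  rw [exQuot, dif_pos h']
  exact (Classical.choose_spec h').symm

/-- Coefficients of the quotient of `g` by `Z - u * W`, where `g` is the difference of `f` and its
image under the reflection `Z ↦ u * W`, `W ↦ u⁻¹ * Z`. -/
theorem coeff_quotient {u : ℂ} (hu : u ≠ 0) {f g Q : R2}
    (hg : ∀ p q, coeff (expo p q) g =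
      coeff (expo p q) f - u ^ q * (u⁻¹) ^ p * coeff (expo q p) f)
    (hQ : (X 0 - C u * X 1) * Q = g) (q : ℕ) : ∀ p : ℕ,
    coeff (expo p q) Q = ∑ x ∈ Finset.range (p + q + 1 + 1), u ^ ((x : ℤ) - (p + 1 : ℕ)) *
      (((if p < x then 1 else 0) - (if x + p < p + q + 1 then 1 else 0)) *
        coeff (expo x (p + q + 1 - x)) f) := by
  have hsum : ∀ (n a b : ℕ) (G : ℕ → ℂ), a < n → b < n →
      ∑ x ∈ Finset.range n, ((if a = x then G x else 0) - (if b = x then G x else 0)) =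
        G a - G b := by
    intro n a b G ha hb
    rw [Finset.sum_sub_distrib, Finset.sum_ite_eq, Finset.sum_ite_eq,
      if_pos (Finset.mem_range.2 ha), if_pos (Finset.mem_range.2 hb)]
  have hpow : ∀ a b : ℕ, u ^ ((a : ℤ) - (b : ℕ)) = u ^ a * (u⁻¹) ^ b := by
    intro a b
    rw [zpow_sub₀ hu, zpow_natCast, zpow_natCast, inv_pow, div_eq_mul_inv]
  induction q with
  | zero =>
    intro p
    have e : coeff (expo (p + 1) 0) g = coeff (expo p 0) Q := by
      rw [← hQ, sub_mul, coeff_sub, expo_succ_left, coeff_X_mul, mul_assoc, coeff_C_mul,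
        coeff_X_mul', if_neg, mul_zero, sub_zero]
      simp [expo]
    rw [← e, hg]
    symm
    trans ∑ x ∈ Finset.range (p + 0 + 1 + 1),
      ((if p + 1 = x then u ^ ((x : ℤ) - (p + 1 : ℕ)) * coeff (expo x (p + 0 + 1 - x)) f else 0) -
       (if 0 = x then u ^ ((x : ℤ) - (p + 1 : ℕ)) * coeff (expo x (p + 0 + 1 - x)) f else 0))
    · refine Finset.sum_congr rfl fun x hx => ?_
      have hx := Finset.mem_range.1 hx
      split_ifs <;> first | omega | ring1
    · rw [hsum _ _ _ _ (by omega) (by omega), hpow, hpow]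
      simp [hu]
  | succ q ih =>
    intro p
    have e : coeff (expo (p + 1) (q + 1)) g =
        coeff (expo p (q + 1)) Q - u * coeff (expo (p + 1) q) Q := by
      rw [← hQ, sub_mul, coeff_sub, expo_succ_left, coeff_X_mul, ← expo_succ_left, mul_assoc,
        coeff_C_mul, expo_succ_right (p + 1), coeff_X_mul]
    have e' : coeff (expo p (q + 1)) Q =
        u * coeff (expo (p + 1) q) Q + coeff (expo (p + 1) (q + 1)) g := by
      rw [e]; ring
    rw [e', ih, hg, Finset.mul_sum]
    symm
    rw [← sub_eq_iff_eq_add']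
    rw [show p + 1 + q + 1 = p + (q + 1) + 1 by ring, ← Finset.sum_sub_distrib]
    trans ∑ x ∈ Finset.range (p + (q + 1) + 1 + 1),
      ((if p + 1 = x then
          u ^ ((x : ℤ) - (p + 1 : ℕ)) * coeff (expo x (p + (q + 1) + 1 - x)) f else 0) -
       (if q + 1 = x then
          u ^ ((x : ℤ) - (p + 1 : ℕ)) * coeff (expo x (p + (q + 1) + 1 - x)) f else 0))
    · refine Finset.sum_congr rfl fun x hx => ?_
      have hx := Finset.mem_range.1 hx
      have hs : u ^ ((x : ℤ) - (p + 1 : ℕ)) = u * u ^ ((x : ℤ) - (p + 1 + 1 : ℕ)) := by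
        rw [← zpow_one_add₀ hu]; congr 1; push_cast; ring
      rw [hs]
      split_ifs <;> first | omega | ring1
    · rw [hsum _ _ _ _ (by omega) (by omega), hpow, hpow,
        show p + (q + 1) + 1 - (p + 1) = q + 1 by omega,
        show p + (q + 1) + 1 - (q + 1) = p + 1 by omega]
      simp [hu]

theorem sum_zeta_zpow {d : ℕ} (hd : d ≠ 0) (n : ℤ) :
    ∑ j ∈ Finset.Icc 1 d, (zeta d ^ j) ^ n = if (d : ℤ) ∣ n then (d : ℂ) else 0 := by
  have hz : IsPrimitiveRoot (zeta d) d := Complex.isPrimitiveRoot_exp d hd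
  have hcomm : ∀ j : ℕ, (zeta d ^ j) ^ n = (zeta d ^ n) ^ j := fun j => by
    rw [← zpow_natCast, ← zpow_natCast, zpow_comm]
  simp only [hcomm]
  split_ifs with h
  · simp [(hz.zpow_eq_one_iff_dvd n).2 h]
  · have hw : zeta d ^ n ≠ 1 := fun h' => h ((hz.zpow_eq_one_iff_dvd n).1 h')
    have hwd : (zeta d ^ n) ^ d = 1 := by rw [← hcomm, hz.pow_eq_one, one_zpow]
    rw [← Finset.Ico_add_one_right_eq_Icc, geom_sum_Ico hw (by omega), pow_succ, hwd]
    simp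

theorem sum_coeff_exQuot_Z {d : ℕ} (hd : d ≠ 0) (f : R2) (p q : ℕ) :
    ∑ j ∈ Finset.Icc 1 d,
      coeff (expo p q) (exQuot (X 0 - C (zeta d ^ j) * X 1) (f - reflAct d j f)) =
    d * ∑ x ∈ Finset.range (p + q + 1 + 1), if (d : ℤ) ∣ (x : ℤ) - (p + 1 : ℕ) then
      ((if p < x then 1 else 0) - (if x + p < p + q + 1 then 1 else 0)) *
        coeff (expo x (p + q + 1 - x)) f else 0 := by
  have hz : ∀ j, zeta d ^ j ≠ 0 := fun j => pow_ne_zero _ (Complex.exp_ne_zero _)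
  rw [Finset.sum_congr rfl fun j _ => coeff_quotient (f := f) (hz j)
    (fun p q => by rw [coeff_sub, coeff_reflAct]) (mul_exQuot (dvd_sub_reflAct d j f)) q p]
  rw [Finset.sum_comm, Finset.mul_sum]
  refine Finset.sum_congr rfl fun x _ => ?_
  rw [← Finset.sum_mul, sum_zeta_zpow hd]
  split_ifs <;> ring

theorem sum_coeff_exQuot_W {d : ℕ} (hd : d ≠ 0) (f : R2) (p q : ℕ) :
    ∑ j ∈ Finset.Icc 1 d,
      coeff (expo p q) (exQuot (X 1 - C ((zeta d ^ j)⁻¹) * X 0) (f - reflAct d j f)) =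
    -(d * ∑ x ∈ Finset.range (p + q + 1 + 1), if (d : ℤ) ∣ (x : ℤ) - p then
      ((if p < x then 1 else 0) - (if x + p < p + q + 1 then 1 else 0)) *
        coeff (expo x (p + q + 1 - x)) f else 0) := by
  have hz : ∀ j, zeta d ^ j ≠ 0 := fun j => pow_ne_zero _ (Complex.exp_ne_zero _)
  have hC : ∀ j, (C (zeta d ^ j)⁻¹ : R2) * C (zeta d ^ j) = 1 := fun j => by
    rw [← C_mul, inv_mul_cancel₀ (hz j), C_1]
  have hdvd : ∀ j, X 1 - C ((zeta d ^ j)⁻¹) * X 0 ∣ f - reflAct d j f := fun j => by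
    refine dvd_trans ⟨-C (zeta d ^ j), ?_⟩ (dvd_sub_reflAct d j f)
    linear_combination -(X 0 : R2) * hC j
  have hquot : ∀ j, (X 0 - C (zeta d ^ j) * X 1) *
      (C (-(zeta d ^ j)⁻¹) * exQuot (X 1 - C ((zeta d ^ j)⁻¹) * X 0) (f - reflAct d j f)) =
      f - reflAct d j f := fun j => by
    conv_rhs => rw [← mul_exQuot (hdvd j)]
    rw [C_neg]
    linear_combination (X 1 : R2) *
      exQuot (X 1 - C ((zeta d ^ j)⁻¹) * X 0) (f - reflAct d j f) * hC j
  have hco : ∀ j ∈ Finset.Icc 1 d,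
      coeff (expo p q) (exQuot (X 1 - C ((zeta d ^ j)⁻¹) * X 0) (f - reflAct d j f)) =
      -∑ x ∈ Finset.range (p + q + 1 + 1), (zeta d ^ j) ^ ((x : ℤ) - p) *
      (((if p < x then 1 else 0) - (if x + p < p + q + 1 then 1 else 0)) *
        coeff (expo x (p + q + 1 - x)) f) := fun j _ => by
    have e := coeff_quotient (f := f) (hz j) (fun p q => by rw [coeff_sub, coeff_reflAct]) (hquot j) q p
    rw [coeff_C_mul] at e
    have hs : ∀ x : ℕ, (zeta d ^ j) ^ ((x : ℤ) - p) =
        zeta d ^ j * (zeta d ^ j) ^ ((x : ℤ) - (p + 1 : ℕ)) := fun x => by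
      rw [← zpow_one_add₀ (hz j)]; congr 1; push_cast; ring
    simp only [hs, mul_assoc]
    rw [← Finset.mul_sum, ← e, neg_mul, mul_neg, neg_neg, mul_inv_cancel_left₀ (hz j)]
  rw [Finset.sum_congr rfl hco, Finset.sum_neg_distrib, Finset.sum_comm, Finset.mul_sum]
  congr 1
  refine Finset.sum_congr rfl fun x _ => ?_
  rw [← Finset.sum_mul, sum_zeta_zpow hd]
  split_ifs <;> ring

/-- Let `F a` be the coefficient of `Z ^ a * W ^ (N - a)` in a singular polynomial; then `hZ` and
`hW` are the coefficientwise forms of `D_Z f = 0` and `D_W f = 0`. The extreme coefficients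
vanish. -/
theorem boundary_zero {d N : ℕ} (hd : 0 < d) (hN : 0 < N) (c : ℂ) (F : ℕ → ℂ)
    (h1 : ∀ r : ℕ, 0 < r → ¬ d ∣ r → c ≠ (r : ℂ) / d)
    (h2 : ∀ n : ℕ, c ≠ (n : ℂ) + 1 / 2)
    (hZ : ∀ a, 0 < a → a ≤ N → (a : ℂ) * F a = c * d * ∑ x ∈ Finset.range (N + 1),
      if (d : ℤ) ∣ (x : ℤ) - a then
        ((if a ≤ x then 1 else 0) - (if x + a ≤ N then 1 else 0)) * F x else 0)
    (hW : ∀ a, a < N → ((N : ℂ) - a) * F a = -(c * d * ∑ x ∈ Finset.range (N + 1),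
      if (d : ℤ) ∣ (x : ℤ) - a then
        ((if a < x then 1 else 0) - (if x + a < N then 1 else 0)) * F x else 0)) :
    F 0 = 0 ∧ F N = 0 := by
  have hd' : (d : ℂ) ≠ 0 := by exact_mod_cast hd.ne'
  have hN' : (N : ℂ) ≠ 0 := by exact_mod_cast hN.ne'
  have eN : (N : ℂ) * F N = c * d * (F N - if d ∣ N then F 0 else 0) := by
    rw [hZ N hN le_rfl]
    congr 1
    have : ∀ x ∈ Finset.range (N + 1), (if (d : ℤ) ∣ (x : ℤ) - N then
        ((if N ≤ x then (1 : ℂ) else 0) - (if x + N ≤ N then 1 else 0)) * F x else 0) =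
        (if N = x then F x else 0) - (if 0 = x then (if d ∣ N then F 0 else 0) else 0) := by
      intro x hx
      have hx := Finset.mem_range.1 hx
      rcases Nat.eq_zero_or_pos x with rfl | h0
      · simp [hN.ne', Int.natCast_dvd_natCast]
        split_ifs <;> simp
      · by_cases hxN : x = N
        · subst hxN; simp [h0.ne', h0.ne]
        · rw [if_neg (show ¬ N ≤ x by omega), if_neg (show ¬ x + N ≤ N by omega),
            if_neg (show ¬ N = x by omega), if_neg (show ¬ 0 = x by omega)]
          simp
    rw [Finset.sum_congr rfl this, Finset.sum_sub_distrib, Finset.sum_ite_eq, Finset.sum_ite_eq]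
    simp
  have e0 : (N : ℂ) * F 0 = c * d * (F 0 - if d ∣ N then F N else 0) := by
    have := hW 0 hN
    rw [Nat.cast_zero, sub_zero] at this
    rw [this, ← mul_neg]
    congr 1
    have : ∀ x ∈ Finset.range (N + 1), (if (d : ℤ) ∣ (x : ℤ) - (0 : ℕ) then
        ((if 0 < x then (1 : ℂ) else 0) - (if x + 0 < N then 1 else 0)) * F x else 0) =
        (if N = x then (if d ∣ N then F N else 0) else 0) - (if 0 = x then F 0 else 0) := by
      intro x hx
      have hx := Finset.mem_range.1 hx
      rcases Nat.eq_zero_or_pos x with rfl | h0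
      · simp [hN.ne', hN]
      · by_cases hxN : x = N
        · subst hxN; simp [h0.ne, h0, Int.natCast_dvd_natCast]
        · rw [if_pos h0, if_pos (show x + 0 < N by omega),
            if_neg (show ¬ N = x by omega), if_neg (show ¬ 0 = x by omega)]
          simp
    rw [Finset.sum_congr rfl this, Finset.sum_sub_distrib, Finset.sum_ite_eq, Finset.sum_ite_eq]
    simp
  by_cases hdN : d ∣ N
  swap
  · have hc : (N : ℂ) - c * d ≠ 0 := fun h => h1 N hN hdN (by
      rw [eq_div_iff hd']; linear_combination -h)
    rw [if_neg hdN] at eN e0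
    have e0' : ((N : ℂ) - c * d) * F 0 = 0 := by linear_combination e0
    have eN' : ((N : ℂ) - c * d) * F N = 0 := by linear_combination eN
    exact ⟨(mul_eq_zero.1 e0').resolve_left hc, (mul_eq_zero.1 eN').resolve_left hc⟩
  rw [if_pos hdN] at eN e0
  have hs : F N = -F 0 := by
    have : (N : ℂ) * (F N + F 0) = 0 := by linear_combination eN + e0
    linear_combination (mul_eq_zero.1 this).resolve_left hN'
  suffices h : F N = F 0 by
    constructor <;> grind
  by_contra hne
  have hF0 : F 0 ≠ 0 := fun h => hne (by rw [hs, h, neg_zero])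
  obtain ⟨K, rfl⟩ := hdN
  have hcK : (K : ℂ) = 2 * c := by
    have : (d : ℂ) * F 0 * (K - 2 * c) = 0 := by
      push_cast at e0; rw [hs] at e0; linear_combination e0
    rcases mul_eq_zero.1 this with h | h
    · exact absurd h (mul_ne_zero hd' hF0)
    · linear_combination h
  rcases Nat.even_or_odd' K with ⟨n, rfl | rfl⟩
  swap
  · refine h2 n ?_
    push_cast at hcK
    linear_combination -hcK / 2
  have hcn : c = n := by push_cast at hcK; linear_combination -hcK / 2
  have hn : 0 < n := by
    rcases Nat.eq_zero_or_pos n with rfl | h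
    · simp at hN
    · exact h
  set N := d * (2 * n) with hNdef
  -- partial sums of `F (d * k) - F (N - d * k)`, taken from the outside
  let B : ℕ → ℂ := fun k => ∑ x ∈ Finset.range (N + 1), if (d : ℤ) ∣ (x : ℤ) then
        ((if d * k < x then 1 else 0) - (if x + d * k < N then 1 else 0)) * F x else 0
  have hdvd : ∀ x k : ℕ, (d : ℤ) ∣ (x : ℤ) - (d * k : ℕ) ↔ (d : ℤ) ∣ (x : ℤ) := fun x k => by
    rw [dvd_sub_left]; push_cast; exact dvd_mul_right _ _
  have hstep : ∀ k, k < 2 * n → B k = B (k + 1) + F (d * (k + 1)) - F (N - d * (k + 1)) := by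
    intro k hk
    have hle : d * (k + 1) ≤ N := Nat.mul_le_mul_left d hk
    have : ∀ x ∈ Finset.range (N + 1), (if (d : ℤ) ∣ (x : ℤ) then
        ((if d * k < x then (1 : ℂ) else 0) - (if x + d * k < N then 1 else 0)) * F x else 0) =
        (if (d : ℤ) ∣ (x : ℤ) then
        ((if d * (k + 1) < x then (1 : ℂ) else 0) -
          (if x + d * (k + 1) < N then 1 else 0)) * F x else 0) +
        (if d * (k + 1) = x then F x else 0) - (if N - d * (k + 1) = x then F x else 0) := by
      intro x hx
      by_cases hx' : d ∣ x
      · obtain ⟨y, rfl⟩ := hx'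
        have c1 : d * k < d * y ↔ k < y := Nat.mul_lt_mul_left hd
        have c2 : d * (k + 1) < d * y ↔ k + 1 < y := Nat.mul_lt_mul_left hd
        have c3 : d * y + d * k < N ↔ y + k < 2 * n := by
          rw [hNdef, ← mul_add]; exact Nat.mul_lt_mul_left hd
        have c4 : d * y + d * (k + 1) < N ↔ y + (k + 1) < 2 * n := by
          rw [hNdef, ← mul_add]; exact Nat.mul_lt_mul_left hd
        have c5 : d * (k + 1) = d * y ↔ k + 1 = y := Nat.mul_right_inj hd.ne'
        have c6 : N - d * (k + 1) = d * y ↔ 2 * n - (k + 1) = y := by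
          rw [hNdef, ← Nat.mul_sub]; exact Nat.mul_right_inj hd.ne'
        have hy : (d : ℤ) ∣ ((d * y : ℕ) : ℤ) := Int.natCast_dvd_natCast.2 (dvd_mul_right d y)
        simp only [c1, c2, c3, c4, c5, c6, hy, if_true]
        split_ifs <;> first | omega | ring1
      · have c5 : d * (k + 1) ≠ x := fun h => hx' ⟨_, h.symm⟩
        have c6 : N - d * (k + 1) ≠ x := fun h => hx' ⟨2 * n - (k + 1), by
          rw [← h, hNdef, Nat.mul_sub]⟩
        simp [Int.natCast_dvd_natCast, hx', c5, c6]
    simp only [B]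
    rw [Finset.sum_congr rfl this, Finset.sum_sub_distrib, Finset.sum_add_distrib,
      Finset.sum_ite_eq, Finset.sum_ite_eq, if_pos (Finset.mem_range.2 (by omega)),
      if_pos (Finset.mem_range.2 (by omega))]
  have hrec : ∀ k, k < 2 * n →
      ((2 * n : ℂ) - k) * (F (d * k) - F (N - d * k)) = - (2 * n * B k) := by
    intro k hk
    have hlt : d * k < N := (Nat.mul_lt_mul_left hd).2 hk
    have w := hW (d * k) hlt
    have z := hZ (N - d * k) (by omega) (by omega)
    have hdz : ∀ x : ℕ, (d : ℤ) ∣ (x : ℤ) - (N - d * k : ℕ) ↔ (d : ℤ) ∣ (x : ℤ) := fun x => by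
      rw [hNdef, ← Nat.mul_sub]; exact hdvd x _
    simp only [hdvd, hdz] at w z
    have hB : (∑ x ∈ Finset.range (N + 1), if (d : ℤ) ∣ (x : ℤ) then
        ((if N - d * k ≤ x then (1 : ℂ) else 0) - (if x + (N - d * k) ≤ N then 1 else 0)) * F x
        else 0) = B k := by
      refine Finset.sum_congr rfl fun x hx => ?_
      split_ifs <;> first | omega | ring1
    rw [hB] at z
    change _ = -(c * d * B k) at w
    rw [Nat.cast_sub hlt.le] at z
    rw [hNdef] at w z
    push_cast at w z
    rw [hcn] at w z
    apply mul_left_cancel₀ hd'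
    linear_combination w - z
  have hB0 : ∀ k, n ≤ k → k < 2 * n → B k = 0 := by
    intro k hk
    induction k, hk using Nat.le_induction with
    | base =>
      intro hk
      have := hrec n hk
      rw [show N - d * n = d * n by rw [hNdef]; lia] at this
      have hn' : (n : ℂ) ≠ 0 := by exact_mod_cast hn.ne'
      simpa [hn'] using this
    | succ k hk ih =>
      intro hk'
      have e1 := hstep k (by omega)
      rw [ih (by omega)] at e1
      have e2 := hrec (k + 1) hk'
      have : ((k : ℂ) + 1) * B (k + 1) = 0 := by
        push_cast at e2
        linear_combination ((2 * n : ℂ) - (k + 1)) * e1 + e2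
      exact (mul_eq_zero.1 this).resolve_left (by exact_mod_cast k.succ_ne_zero)
  have e1 := hstep (2 * n - 1) (by omega)
  rw [hB0 _ (by omega) (by omega), show 2 * n - 1 + 1 = 2 * n by omega, ← hNdef,
    Nat.sub_self] at e1
  have : B (2 * n) = 0 := by
    refine Finset.sum_eq_zero fun x hx => ?_
    have hx := Finset.mem_range.1 hx
    rw [← hNdef]
    split_ifs <;> first | omega | simp
  exact hne (by linear_combination -this - e1)

/-- All coefficients vanish: starting from the extreme ones, `hZ` and `hW` express each coefficient
through those lying further from the middle. -/
theorem slice_zero {d N : ℕ} (hd : 0 < d) (hN : 0 < N) (c : ℂ) (F : ℕ → ℂ)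
    (h1 : ∀ r : ℕ, 0 < r → ¬ d ∣ r → c ≠ (r : ℂ) / d)
    (h2 : ∀ n : ℕ, c ≠ (n : ℂ) + 1 / 2)
    (hZ : ∀ a, 0 < a → a ≤ N → (a : ℂ) * F a = c * d * ∑ x ∈ Finset.range (N + 1),
      if (d : ℤ) ∣ (x : ℤ) - a then
        ((if a ≤ x then 1 else 0) - (if x + a ≤ N then 1 else 0)) * F x else 0)
    (hW : ∀ a, a < N → ((N : ℂ) - a) * F a = -(c * d * ∑ x ∈ Finset.range (N + 1),
      if (d : ℤ) ∣ (x : ℤ) - a then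
        ((if a < x then 1 else 0) - (if x + a < N then 1 else 0)) * F x else 0)) :
    ∀ a, a ≤ N → F a = 0 := by
  have hb := boundary_zero hd hN c F h1 h2 hZ hW
  suffices h : ∀ t a, a ≤ N → (a = t ∨ N - a = t) → F a = 0 from
    fun a ha => h a a ha (Or.inl rfl)
  intro t
  induction t using Nat.strong_induction_on with
  | _ t ih =>
  intro a ha hat
  rcases Nat.eq_zero_or_pos a with rfl | ha0
  · exact hb.1
  rcases eq_or_lt_of_le ha with rfl | haN
  · exact hb.2
  have key : ∀ x, x ≤ N → (x < t ∨ N - x < t) → F x = 0 := fun x hx h =>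
    h.elim (fun h => ih x h x hx (Or.inl rfl)) (fun h => ih _ h x hx (Or.inr rfl))
  by_cases h2a : 2 * a ≤ N
  · have e := hZ a ha0 ha
    rw [Finset.sum_eq_zero, mul_zero] at e
    · exact (mul_eq_zero.1 e).resolve_left (by exact_mod_cast ha0.ne')
    intro x hx
    have hx := Finset.mem_range.1 hx
    have k := key x (by omega)
    split_ifs <;> first | simp; done | omega | (rw [k (by omega)]; simp)
  · have e := hW a haN
    rw [Finset.sum_eq_zero, mul_zero, neg_zero] at e
    · refine (mul_eq_zero.1 e).resolve_left (sub_ne_zero.2 ?_)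
      exact_mod_cast haN.ne'
    intro x hx
    have hx := Finset.mem_range.1 hx
    have k := key x (by omega)
    split_ifs <;> first | simp; done | omega | (rw [k (by omega)]; simp)

/-- For odd `d = 2m+1` and constant parameter `c` which is neither `r/d` for a
positive integer `r` not divisible by `d`, nor `n + 1/2` for an integer `n ≥ 0`,
every singular polynomial is constant. -/
theorem odd_no_singular (m : ℕ) (hm : 1 ≤ m) (c : ℂ)
    (h1 : ∀ r : ℕ, 0 < r → ¬ (2 * m + 1) ∣ r → c ≠ (r : ℂ) / (2 * (m : ℂ) + 1))
    (h2 : ∀ n : ℕ, c ≠ (n : ℂ) + 1 / 2) :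
    ∀ f : R2, DZ (2 * m + 1) (fun _ => c) f = 0 →
      DW (2 * m + 1) (fun _ => c) f = 0 → ∃ a : ℂ, f = C a := by
  intro f hfZ hfW
  have hd : 2 * m + 1 ≠ 0 := by omega
  have hzero : ∀ N, 0 < N → ∀ a, a ≤ N → coeff (expo a (N - a)) f = 0 := by
    intro N hN
    refine slice_zero (Nat.pos_of_ne_zero hd) hN c (fun a => coeff (expo a (N - a)) f)
      (fun r hr hdr => by push_cast; exact h1 r hr hdr) h2 ?_ ?_
    · intro a ha haN
      obtain ⟨p, rfl⟩ : ∃ p, a = p + 1 := ⟨a - 1, by omega⟩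
      obtain ⟨q, rfl⟩ : ∃ q, N = p + q + 1 := ⟨N - (p + 1), by omega⟩
      have e := congrArg (coeff (expo p q)) hfZ
      rw [DZ, coeff_sub, coeff_sum, coeff_zero] at e
      simp only [coeff_C_mul] at e
      rw [← Finset.mul_sum, sum_coeff_exQuot_Z hd, coeff_pderiv, expo_zero, add_comm (expo p q),
        ← expo_succ_left, sub_eq_zero] at e
      simp only [show p + q + 1 - (p + 1) = q by omega, Nat.lt_iff_add_one_le,
        ← add_assoc] at e ⊢
      rw [mul_assoc c, ← e]
      push_cast
      ring
    · intro p hpN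
      obtain ⟨q, rfl⟩ : ∃ q, N = p + q + 1 := ⟨N - (p + 1), by omega⟩
      have e := congrArg (coeff (expo p q)) hfW
      rw [DW, coeff_sub, coeff_sum, coeff_zero] at e
      simp only [coeff_C_mul] at e
      rw [← Finset.mul_sum, sum_coeff_exQuot_W hd, coeff_pderiv, expo_one, add_comm (expo p q),
        ← expo_succ_right, sub_eq_zero] at e
      rw [mul_assoc c, ← mul_neg, ← e, show p + q + 1 - p = q + 1 by omega]
      push_cast
      ring
  refine ⟨coeff 0 f, MvPolynomial.ext _ _ fun s => ?_⟩
  rw [coeff_C]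
  split_ifs with hs
  · rw [hs]
  · have h0 : 0 < s 0 + s 1 := by
      by_contra h
      exact hs (by ext i; fin_cases i <;> simp <;> omega)
    have := hzero (s 0 + s 1) h0 (s 0) (by omega)
    rwa [Nat.add_sub_cancel_left, expo_apply_self] at this

end
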